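/- arXiv:1101.4278 — 2 statements merged into one kernel-verified Lean document; each statement's English description precedes it below -/
import Mathlib

section
/- Let p be an odd prime and n ≥ 0 an integer. Then v_p(ε_{n(p−1)/2}) = −n; in particular ε_{n(p−1)/2} ≠ 0. -/
open Finset

/-- The defining property of the sequence `ε`: `ε 0 = 1` and for each `l ≥ 1`,
`1/(2l+1)! = ∑_{i=1}^{l} ∑_{j₁+⋯+jᵢ=l, jₜ ≥ 1} 2^i εᵢ / ((2j₁)!⋯(2jᵢ)!)`,
the inner sum ranging over ordered `i`-tuples of positive integers summing to `l`. -/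
def IsEpsilon (ε : ℕ → ℚ) : Prop :=
  ε 0 = 1 ∧ ∀ l : ℕ, 1 ≤ l →
    (1 : ℚ) / ((2 * l + 1).factorial : ℚ) =
      ∑ i ∈ Finset.Icc 1 l,
        ∑ c ∈ (Fintype.piFinset fun _ : Fin i => Finset.Icc 1 l).filter
            (fun c => ∑ t, c t = l),
          2 ^ i * ε i / ∏ t, ((2 * c t).factorial : ℚ)

namespace EpsilonSequence

open PowerSeries

/-- The power series `∑_{j ≥ 1} 2 X^j / (2j)!`, that is `2 (cosh √X - 1)`. -/
noncomputable def twoCoshSub : ℚ⟦X⟧ :=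
  PowerSeries.mk fun j => if j = 0 then 0 else 2 / ((2 * j).factorial : ℚ)

/-- The power series `∑ X^l / (2l+1)!`, that is `sinh √X / √X`. -/
noncomputable def sinhDiv : ℚ⟦X⟧ :=
  PowerSeries.mk fun l => 1 / ((2 * l + 1).factorial : ℚ)

/-- The coefficients `(-1)^k (k!)² / (2k+1)!` of the series whose inverse generates `ε`. -/
def invCoeff (k : ℕ) : ℚ :=
  (-1) ^ k * (k.factorial : ℚ) ^ 2 / ((2 * k + 1).factorial : ℚ)

lemma coeff_twoCoshSub {j : ℕ} (hj : j ≠ 0) :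
    coeff j twoCoshSub = 2 / ((2 * j).factorial : ℚ) := by
  simp [twoCoshSub, hj]

lemma constantCoeff_twoCoshSub : constantCoeff twoCoshSub = 0 := by
  rw [← coeff_zero_eq_constantCoeff_apply]
  simp [twoCoshSub]

lemma hasSubst_twoCoshSub : HasSubst twoCoshSub :=
  HasSubst.of_constantCoeff_zero' constantCoeff_twoCoshSub

lemma subst_twoCoshSub_injective {f g : ℚ⟦X⟧}
    (h : (f.subst twoCoshSub : ℚ⟦X⟧) = g.subst twoCoshSub) : f = g := by
  have hu : IsUnit (coeff 1 twoCoshSub) := by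
    rw [coeff_twoCoshSub one_ne_zero]
    simp [Nat.factorial]
  have hs := HasSubst.substInvOfIsUnit twoCoshSub hu
  have key (f : ℚ⟦X⟧) :
      subst (substInvOfIsUnit twoCoshSub hu) (f.subst twoCoshSub : ℚ⟦X⟧) = f := by
    rw [subst_comp_subst_apply hasSubst_twoCoshSub hs,
      subst_substInvOfIsUnit_right _ constantCoeff_twoCoshSub, X_subst]
  rw [← key f, h, key g]

lemma derivative_twoCoshSub : d⁄dX ℚ twoCoshSub = sinhDiv := by
  ext n
  rw [coeff_derivative, coeff_twoCoshSub n.succ_ne_zero]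
  simp only [sinhDiv, coeff_mk]
  rw [show 2 * (n + 1) = (2 * n + 1) + 1 by ring, Nat.factorial_succ]
  have := Nat.cast_ne_zero (R := ℚ).2 (2 * n + 1).factorial_ne_zero
  push_cast
  field_simp
  ring

lemma sinhDiv_add_derivative :
    sinhDiv + 2 * X * d⁄dX ℚ sinhDiv = 1 + C (1 / 2) * twoCoshSub := by
  ext n
  rcases n with _ | n
  · simp [sinhDiv, constantCoeff_twoCoshSub, mul_assoc]
  · rw [map_add, map_add, mul_assoc, ← map_ofNat C 2, coeff_C_mul, coeff_C_mul, coeff_succ_X_mul,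
      coeff_derivative, coeff_twoCoshSub n.succ_ne_zero, coeff_one]
    simp only [sinhDiv, coeff_mk]
    rw [Nat.factorial_succ]
    have := Nat.cast_ne_zero (R := ℚ).2 (2 * (n + 1)).factorial_ne_zero
    push_cast
    simp
    field_simp
    ring

lemma X_mul_sinhDiv_sq :
    X * sinhDiv ^ 2 = twoCoshSub + C (1 / 4) * twoCoshSub ^ 2 := by
  apply derivative.ext
  · have h := sinhDiv_add_derivative
    have h4 : (C (1 / 4) : ℚ⟦X⟧) * 2 = C (1 / 2) := by
      rw [← map_ofNat C 2, ← map_mul]; norm_num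
    simp only [map_add, Derivation.leibniz, derivative_pow, derivative_X, derivative_C,
      smul_eq_mul, derivative_twoCoshSub]
    simp only [Nat.add_one_sub_one, Nat.cast_ofNat, pow_one]
    linear_combination sinhDiv * h - twoCoshSub * sinhDiv * h4
  · simp [constantCoeff_twoCoshSub]

lemma invCoeff_succ (k : ℕ) :
    (2 * (k + 1) + 1) * invCoeff (k + 1) + (k + 1) / 2 * invCoeff k = 0 := by
  unfold invCoeff
  rw [show 2 * (k + 1) + 1 = (2 * k + 1) + 1 + 1 by ring, Nat.factorial_succ (2 * k + 1 + 1),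
    Nat.factorial_succ (2 * k + 1), Nat.factorial_succ k]
  have := Nat.cast_ne_zero (R := ℚ).2 (2 * k + 1).factorial_ne_zero
  push_cast
  have h1 : (2 * (k : ℚ) + 1 + 1 + 1) ≠ 0 := by positivity
  field_simp
  ring

lemma mk_invCoeff_differential :
    (1 + C (1 / 2) * X) * PowerSeries.mk invCoeff +
      2 * (X + C (1 / 4) * X ^ 2) * d⁄dX ℚ (PowerSeries.mk invCoeff) = 1 := by
  have : (1 + C (1 / 2) * X) * PowerSeries.mk invCoeff +
      2 * (X + C (1 / 4) * X ^ 2) * d⁄dX ℚ (PowerSeries.mk invCoeff) =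
      PowerSeries.mk invCoeff + X * (C (1 / 2) * PowerSeries.mk invCoeff
        + C 2 * d⁄dX ℚ (PowerSeries.mk invCoeff)
        + C (1 / 2) * (X * d⁄dX ℚ (PowerSeries.mk invCoeff))) := by
    have h4 : (C (1 / 4) : ℚ⟦X⟧) * 2 = C (1 / 2) := by
      rw [← map_ofNat C 2, ← map_mul]; norm_num
    rw [map_ofNat C 2]
    linear_combination X ^ 2 * d⁄dX ℚ (PowerSeries.mk invCoeff) * h4
  rw [this]
  ext n
  rcases n with _ | n
  · simp [invCoeff]
  · rw [map_add, coeff_succ_X_mul, map_add, map_add, coeff_C_mul, coeff_C_mul, coeff_C_mul,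
      coeff_derivative, coeff_one, coeff_mk, coeff_mk, if_neg n.succ_ne_zero]
    have h := invCoeff_succ n
    rcases n with _ | n
    · simp at h ⊢
      linarith
    · rw [coeff_succ_X_mul, coeff_derivative, coeff_mk]
      push_cast at h ⊢
      linarith

lemma eq_one_of_add_two_X_mul_derivative {u : ℚ⟦X⟧} (h : u + 2 * X * d⁄dX ℚ u = 1) : u = 1 := by
  ext n
  have h' := congrArg (coeff n) h
  rcases n with _ | n
  · simpa [mul_assoc] using h'
  · rw [map_add, mul_assoc, ← map_ofNat C 2, coeff_C_mul, coeff_succ_X_mul, coeff_derivative,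
      coeff_one, if_neg n.succ_ne_zero] at h'
    rw [coeff_one, if_neg n.succ_ne_zero]
    have h3 : coeff (n + 1) u * (2 * n + 3) = 0 := by linarith
    exact (mul_eq_zero.1 h3).resolve_right (by positivity)

lemma sinhDiv_mul_subst : sinhDiv * (PowerSeries.mk invCoeff).subst twoCoshSub = 1 := by
  apply eq_one_of_add_two_X_mul_derivative
  have hs := hasSubst_twoCoshSub
  have hd := congrArg (substAlgHom (R := ℚ) hs) mk_invCoeff_differential
  have hC (r : ℚ) : substAlgHom (R := ℚ) hs (C r) = C r := by
    simpa using (substAlgHom (R := ℚ) hs).commutes r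
  simp only [map_add, map_mul, map_one, map_pow, hC, substAlgHom_X, map_ofNat] at hd
  simp only [coe_substAlgHom] at hd
  rw [Derivation.leibniz, derivative_subst hs, derivative_twoCoshSub, smul_eq_mul, smul_eq_mul]
  rw [← X_mul_sinhDiv_sq, ← sinhDiv_add_derivative] at hd
  linear_combination hd

lemma coeff_twoCoshSub_pow (i l : ℕ) :
    coeff l (twoCoshSub ^ i) =
      ∑ c ∈ (Fintype.piFinset fun _ : Fin i => Finset.Icc 1 l).filter (fun c => ∑ t, c t = l),
        2 ^ i / ∏ t, ((2 * c t).factorial : ℚ) := by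
  have h := coeff_prod (fun _ : Fin i => twoCoshSub) l Finset.univ
  rw [Finset.prod_const, Finset.card_univ, Fintype.card_fin] at h
  rw [h]
  symm
  refine Finset.sum_of_injOn (fun c => Finsupp.equivFunOnFinite.symm c)
    (Finsupp.equivFunOnFinite.symm.injective.injOn) ?_ ?_ ?_
  · intro c hc
    simp only [Finset.coe_filter, Set.mem_ofPred_eq] at hc
    simp [Finset.mem_finsuppAntidiag, hc.2]
  · intro f hf hf'
    by_contra hne
    apply hf'
    rw [Finset.mem_finsuppAntidiag] at hf
    refine ⟨f, ?_, by simp⟩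
    simp only [Finset.coe_filter, Set.mem_ofPred_eq, Fintype.mem_piFinset, Finset.mem_Icc]
    refine ⟨fun t => ⟨Nat.one_le_iff_ne_zero.2 fun h0 => ?_, ?_⟩, hf.1⟩
    · exact hne (Finset.prod_eq_zero (Finset.mem_univ t) (by rw [h0]; simp [twoCoshSub]))
    · rw [← hf.1]
      exact Finset.single_le_sum (f := fun t => f t) (fun _ _ => Nat.zero_le _) (Finset.mem_univ t)
  · intro c hc
    simp only [Finset.mem_filter, Fintype.mem_piFinset, Finset.mem_Icc] at hc
    have : ∀ t, coeff (c t) twoCoshSub = 2 / ((2 * c t).factorial : ℚ) :=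
      fun t => coeff_twoCoshSub (by have := (hc.1 t).1; omega)
    simp [this, Finset.prod_div_distrib]

lemma coeff_pow_eq_zero_of_lt {f : ℚ⟦X⟧} (hf : constantCoeff f = 0) {i l : ℕ} (h : l < i) :
    coeff l (f ^ i) = 0 :=
  X_pow_dvd_iff.1 (pow_dvd_pow_of_dvd (X_dvd_iff.2 hf) i) l h

lemma subst_mk_epsilon {ε : ℕ → ℚ} (hε : IsEpsilon ε) :
    (PowerSeries.mk ε).subst twoCoshSub = sinhDiv := by
  ext l
  rw [coeff_subst' hasSubst_twoCoshSub, finsum_eq_sum_of_support_subset (s := Finset.range (l + 1))]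
  · rcases Nat.eq_zero_or_pos l with rfl | hl
    · simp [sinhDiv, hε.1]
    · simp only [sinhDiv, coeff_mk]
      rw [hε.2 l hl, Finset.range_eq_Ico, Finset.sum_eq_sum_Ico_succ_bot (by omega)]
      simp only [pow_zero, coeff_one, if_neg hl.ne', zero_add, smul_eq_mul, mul_zero]
      refine Finset.sum_congr (by ext; simp) fun i _ => ?_
      rw [coeff_twoCoshSub_pow, Finset.mul_sum]
      exact Finset.sum_congr rfl fun c _ => by ring
  · intro i hi
    rw [Finset.coe_range, Set.mem_Iio]
    by_contra h
    exact hi (by simp [coeff_pow_eq_zero_of_lt constantCoeff_twoCoshSub (show l < i by omega)])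

lemma mk_epsilon_mul_mk_invCoeff {ε : ℕ → ℚ} (hε : IsEpsilon ε) :
    PowerSeries.mk ε * PowerSeries.mk invCoeff = 1 := by
  apply subst_twoCoshSub_injective
  rw [subst_mul hasSubst_twoCoshSub, subst_mk_epsilon hε, sinhDiv_mul_subst]
  rw [← coe_substAlgHom hasSubst_twoCoshSub, map_one]

lemma epsilon_succ {ε : ℕ → ℚ} (hε : IsEpsilon ε) (m : ℕ) :
    ε (m + 1) = -∑ k ∈ Finset.range (m + 1), invCoeff (k + 1) * ε (m - k) := by
  have h := congrArg (coeff (m + 1)) (mk_epsilon_mul_mk_invCoeff hε)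
  rw [mul_comm, coeff_mul, coeff_one, if_neg m.succ_ne_zero,
    Finset.Nat.sum_antidiagonal_eq_sum_range_succ_mk, Finset.sum_range_succ'] at h
  simp only [coeff_mk, Nat.add_sub_add_right, Nat.sub_zero] at h
  rw [show invCoeff 0 = 1 by simp [invCoeff], one_mul] at h
  linarith

/-- `q` is zero or `h * v_p(q) ≥ w`. -/
def ScaledValGE (p h : ℕ) (w : ℤ) (q : ℚ) : Prop :=
  q ≠ 0 → w ≤ h * padicValRat p q

lemma ScaledValGE.neg {p h : ℕ} {w : ℤ} {q : ℚ} (hq : ScaledValGE p h w q) :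
    ScaledValGE p h w (-q) := fun h0 => by
  rw [padicValRat.neg]
  exact hq (neg_ne_zero.1 h0)

section Valuation

variable {p : ℕ} [Fact p.Prime]

lemma invCoeff_ne_zero (k : ℕ) : invCoeff k ≠ 0 := by
  unfold invCoeff
  positivity

lemma padicValRat_invCoeff (k : ℕ) :
    padicValRat p (invCoeff k) =
      2 * (padicValNat p k.factorial : ℤ) - padicValNat p (2 * k + 1).factorial := by
  have h1 := Nat.cast_ne_zero (R := ℚ).2 (2 * k + 1).factorial_ne_zero
  have h2 := Nat.cast_ne_zero (R := ℚ).2 k.factorial_ne_zero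
  have h3 : ((-1 : ℚ) ^ k) ≠ 0 := by positivity
  unfold invCoeff
  rw [padicValRat.div (mul_ne_zero h3 (pow_ne_zero 2 h2)) h1,
    padicValRat.mul h3 (pow_ne_zero 2 h2), padicValRat.pow, padicValRat.pow, padicValRat.neg,
    padicValRat.one, padicValRat.of_nat, padicValRat.of_nat]
  simp

lemma padicValNat_factorial_of_lt {n : ℕ} (h : n < p) : padicValNat p n.factorial = 0 :=
  padicValNat.eq_zero_of_not_dvd fun hd =>
    (((Fact.out : p.Prime).dvd_factorial).1 hd).not_gt h

lemma padicValRat_invCoeff_half {h : ℕ} (hp : p = 2 * h + 1) : padicValRat p (invCoeff h) = -1 := by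
  rw [padicValRat_invCoeff, padicValNat_factorial_of_lt (by omega), ← hp]
  have := padicValNat_factorial_mul (p := p) 1
  rw [mul_one] at this
  rw [this]
  simp

lemma neg_lt_mul_padicValRat_invCoeff {h k : ℕ} (hp : p = 2 * h + 1) (hk : k ≠ 0) (hkh : k ≠ h) :
    -(k : ℤ) < h * padicValRat p (invCoeff k) := by
  rw [padicValRat_invCoeff]
  rcases lt_or_ge k p with hkp | hkp
  · rw [padicValNat_factorial_of_lt hkp]
    rcases lt_or_ge (2 * k + 1) p with hlt | hge
    · rw [padicValNat_factorial_of_lt hlt]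
      simp
      omega
    · obtain ⟨r, hr⟩ := Nat.exists_eq_add_of_le hge
      have h1 := padicValNat_factorial_mul_add (p := p) (n := r) 1 (by omega)
      have h2 := padicValNat_factorial_mul (p := p) 1
      rw [mul_one] at h1 h2
      rw [hr, h1, h2]
      simp
      omega
  · have e1 := sub_one_mul_padicValNat_factorial_lt_of_ne_zero p (2 * k).succ_ne_zero
    have v1 : 1 ≤ padicValNat p k.factorial :=
      one_le_padicValNat_of_dvd k.factorial_ne_zero (((Fact.out : p.Prime).dvd_factorial).2 hkp)
    have hh : 1 ≤ h := by have := (Fact.out : p.Prime).two_le; omega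
    have e2 : h ≤ h * padicValNat p k.factorial := Nat.le_mul_of_pos_right _ v1
    rw [show p - 1 = 2 * h by omega, mul_assoc] at e1
    have e3 : h * padicValNat p (2 * k + 1).factorial ≤ k := by
      have : 2 * (h * padicValNat p (2 * k + 1).factorial) < 2 * k + 1 := e1
      omega
    generalize padicValNat p k.factorial = a at *
    generalize padicValNat p (2 * k + 1).factorial = b at *
    have e2' : (h : ℤ) ≤ h * a := by exact_mod_cast e2
    have e3' : (h : ℤ) * b ≤ k := by exact_mod_cast e3
    have hh' : (1 : ℤ) ≤ h := by exact_mod_cast hh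
    linarith

lemma ScaledValGE.mul {h : ℕ} {v w : ℤ} {q r : ℚ} (hq : ScaledValGE p h v q)
    (hr : ScaledValGE p h w r) : ScaledValGE p h (v + w) (q * r) := fun h0 => by
  have hq0 := left_ne_zero_of_mul h0
  have hr0 := right_ne_zero_of_mul h0
  rw [padicValRat.mul hq0 hr0, mul_add]
  exact add_le_add (hq hq0) (hr hr0)

lemma ScaledValGE.add {h : ℕ} {w : ℤ} {q r : ℚ} (hq : ScaledValGE p h w q)
    (hr : ScaledValGE p h w r) : ScaledValGE p h w (q + r) := fun h0 => by
  rcases eq_or_ne q 0 with rfl | hq0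
  · simpa using hr (by simpa using h0)
  rcases eq_or_ne r 0 with rfl | hr0
  · simpa using hq (by simpa using h0)
  have hm := padicValRat.min_le_padicValRat_add (p := p) h0
  have hh : (0 : ℤ) ≤ h := Int.natCast_nonneg h
  rcases min_le_iff.1 hm with hm | hm
  · exact (hq hq0).trans (mul_le_mul_of_nonneg_left hm hh)
  · exact (hr hr0).trans (mul_le_mul_of_nonneg_left hm hh)

lemma ScaledValGE.sum {ι : Type*} {h : ℕ} {w : ℤ} {f : ι → ℚ} {s : Finset ι}
    (hf : ∀ i ∈ s, ScaledValGE p h w (f i)) : ScaledValGE p h w (∑ i ∈ s, f i) :=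
  Finset.sum_induction f (ScaledValGE p h w) (fun _ _ ha hb => ha.add hb)
    (fun h0 => absurd rfl h0) hf

lemma scaledValGE_invCoeff {h k : ℕ} (hp : p = 2 * h + 1) (hk : k ≠ 0) :
    ScaledValGE p h (-k) (invCoeff k) := fun _ => by
  rcases eq_or_ne k h with rfl | hkh
  · rw [padicValRat_invCoeff_half hp]
    simp
  · exact (neg_lt_mul_padicValRat_invCoeff hp hk hkh).le

lemma scaledValGE_epsilon {ε : ℕ → ℚ} (hε : IsEpsilon ε) {h : ℕ} (hp : p = 2 * h + 1) (m : ℕ) :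
    ScaledValGE p h (-m) (ε m) := by
  induction m using Nat.strong_induction_on with
  | _ m ih =>
    rcases m with _ | m
    · rw [hε.1]
      simp [ScaledValGE]
    · rw [epsilon_succ hε]
      refine (ScaledValGE.sum fun k hk => ?_).neg
      rw [Finset.mem_range] at hk
      have := (scaledValGE_invCoeff hp k.succ_ne_zero).mul (ih (m - k) (by omega))
      rwa [show -((k + 1 : ℕ) : ℤ) + -((m - k : ℕ) : ℤ) = -((m + 1 : ℕ) : ℤ) by omega] at this

lemma padicValRat_epsilon_mul {ε : ℕ → ℚ} (hε : IsEpsilon ε) {h : ℕ} (hp : p = 2 * h + 1) (n : ℕ) :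
    padicValRat p (ε (n * h)) = -(n : ℤ) ∧ ε (n * h) ≠ 0 := by
  have hh : 1 ≤ h := by have := (Fact.out : p.Prime).two_le; omega
  induction n with
  | zero => simp [hε.1]
  | succ n ih =>
    obtain ⟨m, hm⟩ : ∃ m, (n + 1) * h = m + 1 :=
      Nat.exists_eq_add_of_le' (Nat.mul_pos n.succ_pos hh)
    have hnm : n * h = m - (h - 1) := by rw [add_mul, one_mul] at hm; omega
    have hmem : h - 1 ∈ Finset.range (m + 1) := by
      rw [Finset.mem_range]; rw [add_mul, one_mul] at hm; omega
    have hrec := epsilon_succ hε m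
    rw [← Finset.add_sum_erase _ _ hmem, Nat.sub_add_cancel hh, ← hnm, neg_add] at hrec
    set a := invCoeff h * ε (n * h) with ha
    set r := ∑ k ∈ (Finset.range (m + 1)).erase (h - 1), invCoeff (k + 1) * ε (m - k)
    have ha0 : a ≠ 0 := mul_ne_zero (invCoeff_ne_zero h) ih.2
    have hva : padicValRat p a = -((n + 1 : ℕ) : ℤ) := by
      rw [ha, padicValRat.mul (invCoeff_ne_zero h) ih.2, ih.1, padicValRat_invCoeff_half hp]
      push_cast; ring
    have hr : ScaledValGE p h (-((m + 1 : ℕ) : ℤ) + 1) r := by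
      refine ScaledValGE.sum fun k hk => ?_
      rw [Finset.mem_erase, Finset.mem_range] at hk
      have hb : ScaledValGE p h (-((k + 1 : ℕ) : ℤ) + 1) (invCoeff (k + 1)) := fun _ =>
        neg_lt_mul_padicValRat_invCoeff hp k.succ_ne_zero (by omega)
      have := hb.mul (scaledValGE_epsilon hε hp (m - k))
      rwa [show -((k + 1 : ℕ) : ℤ) + 1 + -((m - k : ℕ) : ℤ) = -((m + 1 : ℕ) : ℤ) + 1 by
        omega] at this
    rw [hm, hrec, ← neg_add, padicValRat.neg, neg_ne_zero]
    rcases eq_or_ne r 0 with hr0 | hr0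
    · rw [hr0, add_zero]
      exact ⟨hva, ha0⟩
    · have hlt : padicValRat p a < padicValRat p r := by
        have h1 := hr hr0
        rw [← hm] at h1
        rw [hva]
        have h2 : (h : ℤ) * -((n + 1 : ℕ) : ℤ) < h * padicValRat p r := by
          push_cast at h1 ⊢
          linarith
        exact lt_of_mul_lt_mul_left h2 (Int.natCast_nonneg h)
      have hne : a + r ≠ 0 := fun h0 => by
        rw [eq_neg_of_add_eq_zero_left h0, padicValRat.neg] at hlt
        exact lt_irrefl _ hlt
      exact ⟨(padicValRat.add_eq_of_lt hne ha0 hr0 hlt).trans hva, hne⟩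

end Valuation

end EpsilonSequence

theorem padicValRat_epsilon_odd_prime (ε : ℕ → ℚ) (hε : IsEpsilon ε) (p : ℕ)
    (hp : p.Prime) (hodd : p ≠ 2) (n : ℕ) :
    padicValRat p (ε (n * (p - 1) / 2)) = -(n : ℤ) ∧ ε (n * (p - 1) / 2) ≠ 0 := by
  have := Fact.mk hp
  obtain ⟨h, hh⟩ := hp.odd_of_ne_two hodd
  have hidx : n * (p - 1) / 2 = n * h := by
    rw [show n * (p - 1) = 2 * (n * h) by rw [hh, Nat.add_sub_cancel]; ring]
    exact Nat.mul_div_cancel_left _ two_pos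
  rw [hidx]
  exact EpsilonSequence.padicValRat_epsilon_mul hε hh n
end

section
/- For every integer l ≥ 1: if l ≢ 3 (mod 10), then v_5(ε_l) = −⌊l/2⌋; and if l ≡ 3 (mod 10), then either ε_l = 0 or v_5(ε_l) ≥ −⌊l/2⌋ + 1. -/
open Finset

section

open PowerSeries

/-- The power series of `cosh √X`. -/
noncomputable def coshSqrt : ℚ⟦X⟧ := .mk fun n => 1 / ((2 * n).factorial : ℚ)

/-- The power series of `sinh √X / √X`. -/
noncomputable def sinhcSqrt : ℚ⟦X⟧ := .mk fun n => 1 / ((2 * n + 1).factorial : ℚ)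

lemma two_mul_derivative_coshSqrt : 2 * d⁄dX ℚ coshSqrt = sinhcSqrt := by
  ext n
  rw [two_mul, map_add]
  simp only [coeff_derivative, coshSqrt, sinhcSqrt, coeff_mk]
  rw [show 2 * (n + 1) = (2 * n + 1) + 1 by ring, Nat.factorial_succ (2 * n + 1)]
  have := Nat.factorial_ne_zero (2 * n + 1)
  push_cast
  field_simp
  ring

lemma two_mul_X_mul_derivative_sinhcSqrt : 2 * (X * d⁄dX ℚ sinhcSqrt) + sinhcSqrt = coshSqrt := by
  ext n
  rw [two_mul, map_add, map_add]
  cases n with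
  | zero => simp [coshSqrt, sinhcSqrt]
  | succ n =>
    simp only [coeff_succ_X_mul, coeff_derivative, coshSqrt, sinhcSqrt, coeff_mk]
    rw [Nat.factorial_succ (2 * (n + 1))]
    have := Nat.factorial_ne_zero (2 * (n + 1))
    push_cast
    field_simp
    ring

lemma coshSqrt_sq : coshSqrt ^ 2 = 1 + X * sinhcSqrt ^ 2 := by
  apply derivative.ext
  · have h1 := two_mul_derivative_coshSqrt
    have h2 := two_mul_X_mul_derivative_sinhcSqrt
    simp only [map_add, pow_two, Derivation.leibniz, smul_eq_mul, Derivation.map_one_eq_zero,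
      derivative_X]
    linear_combination coshSqrt * h1 - sinhcSqrt * h2
  · simp [coshSqrt]

/-- The power series of `2 (cosh √X - 1)`. -/
noncomputable def substSeries : ℚ⟦X⟧ := 2 * (coshSqrt - 1)

lemma hasSubst_substSeries : HasSubst substSeries :=
  .of_constantCoeff_zero' (by simp [substSeries, coshSqrt])

/-- The reciprocal of the generating function of a sequence satisfying `IsEpsilon`. -/
noncomputable def recipSeries : ℚ⟦X⟧ :=
  .mk fun n => (-1) ^ n / ((2 * n + 1) * n.centralBinom : ℚ)

lemma recipSeries_ode : (4 * X + X ^ 2) * d⁄dX ℚ recipSeries + (2 + X) * recipSeries = 2 := by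
  have key : ∀ n : ℕ,
      (4 * n + 6) * ((-1) ^ (n + 1) / ((2 * (n + 1 : ℕ) + 1) * (n + 1).centralBinom : ℚ))
      + (n + 1) * ((-1) ^ n / ((2 * n + 1) * n.centralBinom : ℚ)) = 0 := by
    intro n
    have h : ((n : ℚ) + 1) * (n + 1).centralBinom = 2 * (2 * n + 1) * n.centralBinom := by
      exact_mod_cast Nat.succ_mul_centralBinom_succ n
    have h0 : (n.centralBinom : ℚ) ≠ 0 := by exact_mod_cast n.centralBinom_ne_zero
    have h1 : ((n + 1).centralBinom : ℚ) = 2 * (2 * n + 1) * n.centralBinom / (n + 1) := by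
      field_simp; linarith
    rw [h1]
    push_cast
    field_simp
    ring
  have e : (4 * X + X ^ 2) * d⁄dX ℚ recipSeries + (2 + X) * recipSeries
      = C 4 * (X * d⁄dX ℚ recipSeries) + X * (X * d⁄dX ℚ recipSeries)
        + C 2 * recipSeries + X * recipSeries := by
    simp only [map_ofNat]
    ring
  rw [e, ← map_ofNat C 2]
  ext n
  simp only [map_add, coeff_C_mul]
  match n with
  | 0 => simp [recipSeries]
  | 1 =>
    have := key 0
    have h0 : constantCoeff (d⁄dX ℚ recipSeries) = coeff 1 recipSeries := by
      rw [← coeff_zero_eq_constantCoeff_apply, coeff_derivative]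
      simp
    have h1 (f : ℚ⟦X⟧) : coeff 1 (X * f) = constantCoeff f := by
      simp
    simp only [h1, map_mul, h0, coeff_C]
    simp [recipSeries] at this ⊢
    linear_combination this
  | n + 2 =>
    have := key (n + 1)
    simp [coeff_succ_X_mul, coeff_derivative, recipSeries] at this ⊢
    linear_combination this

lemma sinhcSqrt_mul_recipSeries_subst : sinhcSqrt * recipSeries.subst substSeries = 1 := by
  have hs := hasSubst_substSeries
  have h := congrArg (substAlgHom hs) recipSeries_ode
  simp only [map_add, map_mul, map_pow, map_ofNat, substAlgHom_X] at h
  simp only [coe_substAlgHom] at h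
  have hd := derivative_subst (R := ℚ) (f := recipSeries) hs
  have hU : d⁄dX ℚ substSeries = sinhcSqrt := by
    rw [← two_mul_derivative_coshSqrt, substSeries, two_mul, two_mul]
    simp
  rw [hU] at hd
  have h2 := two_mul_X_mul_derivative_sinhcSqrt
  have h3 := coshSqrt_sq
  set P := recipSeries.subst substSeries
  set Q := (d⁄dX ℚ recipSeries).subst substSeries
  have h4 : C 2 * (X * d⁄dX ℚ (sinhcSqrt * P)) + sinhcSqrt * P = C 1 := by
    have : (2 : ℚ⟦X⟧) ≠ 0 := fun h0 => by
      simpa [map_ofNat] using congrArg constantCoeff h0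
    apply mul_left_cancel₀ this
    simp only [Derivation.leibniz, smul_eq_mul, map_ofNat, map_one]
    rw [hd]
    rw [substSeries] at h
    linear_combination h + 2 * P * h2 - 4 * Q * h3
  ext n
  have h5 := congrArg (coeff n) h4
  cases n with
  | zero => simpa using h5
  | succ n =>
    simp only [map_add, coeff_C_mul, coeff_succ_X_mul, coeff_derivative, coeff_C, coeff_one,
      Nat.add_eq_zero_iff, one_ne_zero, and_false, if_false] at h5 ⊢
    have h6 : (2 * ((n : ℚ) + 1) + 1) * coeff (n + 1) (sinhcSqrt * P) = 0 := by
      linear_combination h5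
    have h7 : 2 * ((n : ℚ) + 1) + 1 ≠ 0 := by positivity
    exact (mul_eq_zero.mp h6).resolve_left h7

lemma subst_substSeries_injective {f g : ℚ⟦X⟧}
    (h : f.subst substSeries = g.subst substSeries) : f = g := by
  have h0 : constantCoeff substSeries = 0 := by simp [substSeries, coshSqrt]
  have h1 : coeff 1 substSeries = 1 := by
    rw [substSeries, two_mul]
    simp [coshSqrt, coeff_one]
    norm_num
  have hu : IsUnit (coeff 1 substSeries) := by simp [h1]
  have hV := subst_substInvOfIsUnit_right substSeries h0 hu
  have := congrArg (subst (substSeries.substInvOfIsUnit hu)) h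
  rwa [subst_comp_subst_apply hasSubst_substSeries (HasSubst.substInvOfIsUnit _ hu),
    subst_comp_subst_apply hasSubst_substSeries (HasSubst.substInvOfIsUnit _ hu), hV,
    X_subst, X_subst] at this

lemma coeff_pow_eq_sum_positive_tuples {f : ℚ⟦X⟧} (hf : constantCoeff f = 0) (i l : ℕ) :
    coeff l (f ^ i) = ∑ c ∈ (Fintype.piFinset fun _ : Fin i => Finset.Icc 1 l).filter
            (fun c => ∑ t, c t = l), ∏ t, coeff (c t) f := by
  have h := coeff_prod (fun _ : Fin i => f) l Finset.univ
  rw [Finset.prod_const, Finset.card_univ, Fintype.card_fin] at h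
  rw [h]
  have h2 : ∑ c ∈ finsuppAntidiag (univ : Finset (Fin i)) l, ∏ t, coeff (c t) f =
      ∑ c ∈ piAntidiag (univ : Finset (Fin i)) l, ∏ t, coeff (c t) f := by
    refine Finset.sum_nbij' (fun c => ⇑c) Finsupp.equivFunOnFinite.symm ?_ ?_ ?_ ?_ ?_
    · intro c hc
      simpa using hc
    · intro c hc
      simpa using hc
    · intro c _
      ext; simp
    · intro c _
      ext; simp
    · intro c _
      rfl
  rw [h2]
  symm
  apply Finset.sum_subset
  · intro c hc
    simp at hc ⊢
    exact hc.2
  · intro c hc hc'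
    simp only [mem_filter, Fintype.mem_piFinset, mem_Icc, mem_piAntidiag] at hc hc'
    obtain ⟨t, ht⟩ : ∃ t, c t = 0 := by
      by_contra! hne
      refine hc' ⟨fun t => ⟨Nat.one_le_iff_ne_zero.mpr (hne t), ?_⟩, hc.1⟩
      rw [← hc.1]
      exact Finset.single_le_sum (fun _ _ => Nat.zero_le _) (mem_univ t)
    exact Finset.prod_eq_zero (mem_univ t) (by simpa [ht] using hf)

lemma IsEpsilon.subst_eq {ε : ℕ → ℚ} (hε : IsEpsilon ε) :
    (PowerSeries.mk ε).subst substSeries = sinhcSqrt := by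
  have h0 : constantCoeff (coshSqrt - 1) = 0 := by simp [coshSqrt]
  have hpow (i l : ℕ) : coeff l (substSeries ^ i) = 2 ^ i * coeff l ((coshSqrt - 1) ^ i) := by
    rw [substSeries, mul_pow, ← map_ofNat C 2, ← map_pow, coeff_C_mul]
  ext l
  rw [coeff_subst' hasSubst_substSeries]
  rcases Nat.eq_zero_or_pos l with rfl | hl
  · rw [finsum_eq_single _ 0]
    · simp [hε.1, sinhcSqrt]
    · intro i hi
      simp [hpow, h0, hi]
  · rw [finsum_eq_sum_of_support_subset (s := Finset.Icc 1 l), sinhcSqrt, coeff_mk,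
      hε.2 l hl]
    · refine Finset.sum_congr rfl fun i _ => ?_
      rw [coeff_mk, hpow, coeff_pow_eq_sum_positive_tuples h0, smul_eq_mul, Finset.mul_sum,
        Finset.mul_sum]
      refine Finset.sum_congr rfl fun c hc => ?_
      simp only [mem_filter, Fintype.mem_piFinset, mem_Icc] at hc
      have (t : Fin i) : coeff (c t) (coshSqrt - 1) = ((2 * c t).factorial : ℚ)⁻¹ := by
        have := (hc.1 t).1
        rw [map_sub, coeff_one, if_neg (by lia), sub_zero, coshSqrt, coeff_mk, one_div]
      simp only [this, Finset.prod_inv_distrib]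
      ring
    · intro i hi
      rw [Function.mem_support] at hi
      rw [Finset.coe_Icc, Set.mem_Icc]
      by_contra hcon
      apply hi
      rw [smul_eq_mul, hpow]
      rcases Nat.eq_zero_or_pos i with rfl | hi0
      · simp [coeff_one, hl.ne']
      · rw [coeff_of_lt_order l, mul_zero, mul_zero]
        refine lt_of_lt_of_le ?_ (le_order_pow_of_constantCoeff_eq_zero i h0)
        exact_mod_cast (by lia : l < i)

lemma IsEpsilon.mul_eq_one {ε : ℕ → ℚ} (hε : IsEpsilon ε) :
    recipSeries * PowerSeries.mk ε = 1 := by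
  apply subst_substSeries_injective
  rw [subst_mul hasSubst_substSeries, hε.subst_eq, mul_comm, sinhcSqrt_mul_recipSeries_subst]
  exact (map_one (substAlgHom (R := ℚ) hasSubst_substSeries)).symm.trans (by rw [coe_substAlgHom])

lemma IsEpsilon.sum_eq_zero {ε : ℕ → ℚ} (hε : IsEpsilon ε) {l : ℕ} (hl : l ≠ 0) :
    ∑ n ∈ range (l + 1), (-1) ^ n / ((2 * n + 1) * n.centralBinom : ℚ) * ε (l - n) = 0 := by
  have h := congrArg (coeff l) hε.mul_eq_one
  rw [coeff_mul, Finset.Nat.sum_antidiagonal_eq_sum_range_succ_mk, coeff_one, if_neg hl] at h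
  simpa [recipSeries] using h

end

local instance : Fact (Nat.Prime 5) := ⟨Nat.prime_five⟩

/-- `q` is congruent to the integer `m` modulo `5` in the localization of `ℤ` at `5`. -/
def CongFive (q : ℚ) (m : ℤ) : Prop := padicNorm 5 (q - m) < 1

namespace CongFive

lemma congr {q : ℚ} {m n : ℤ} (h : CongFive q m) (hmn : m ≡ n [ZMOD 5]) : CongFive q n := by
  have h2 : padicNorm 5 ((m - n : ℤ) : ℚ) < 1 :=
    (padicNorm.int_lt_one_iff _).mpr hmn.symm.dvd
  have := (padicNorm.nonarchimedean (p := 5)).trans_lt (max_lt h h2)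
  rwa [show q - m + ((m - n : ℤ) : ℚ) = q - n by push_cast; ring] at this

lemma norm_le {q : ℚ} {m : ℤ} (h : CongFive q m) : padicNorm 5 q ≤ 1 := by
  have := (padicNorm.nonarchimedean (p := 5)).trans (max_le h.le (padicNorm.of_int m))
  rwa [sub_add_cancel] at this

lemma add {q r : ℚ} {m n : ℤ} (hq : CongFive q m) (hr : CongFive r n) :
    CongFive (q + r) (m + n) := by
  have := (padicNorm.nonarchimedean (p := 5)).trans_lt (max_lt hq hr)
  rwa [show q - m + (r - n) = q + r - ((m + n : ℤ) : ℚ) by push_cast; ring] at this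

lemma mul {q r : ℚ} {m n : ℤ} (hq : CongFive q m) (hr : CongFive r n) :
    CongFive (q * r) (m * n) := by
  have h1 : padicNorm 5 (q * (r - n)) < 1 := by
    rw [padicNorm.mul]
    exact mul_lt_one_of_nonneg_of_lt_one_right hq.norm_le (padicNorm.nonneg _) hr
  have h2 : padicNorm 5 ((q - m) * n) < 1 := by
    rw [padicNorm.mul]
    exact mul_lt_one_of_nonneg_of_lt_one_left (padicNorm.nonneg _) hq (padicNorm.of_int _)
  have := (padicNorm.nonarchimedean (p := 5)).trans_lt (max_lt h1 h2)
  rwa [show q * (r - n) + (q - m) * n = q * r - ((m * n : ℤ) : ℚ) by push_cast; ring] at this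

lemma neg {q : ℚ} {m : ℤ} (hq : CongFive q m) : CongFive (-q) (-m) := by
  rw [CongFive, ← padicNorm.neg] at hq
  rwa [CongFive, show -q - ((-m : ℤ) : ℚ) = -(q - m) by push_cast; ring]

lemma div (a : ℤ) {b m : ℤ} (hb : ¬ 5 ∣ b) (h : a ≡ m * b [ZMOD 5]) :
    CongFive ((a : ℚ) / b) m := by
  have hb0 : (b : ℚ) ≠ 0 := by
    intro h0
    exact hb (by simp [Int.cast_eq_zero.mp h0])
  rw [CongFive, show (a : ℚ) / b - m = ((a - m * b : ℤ) : ℚ) / (b : ℤ) by push_cast; field_simp,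
    padicNorm.div, (padicNorm.int_eq_one_iff (p := 5) b).mpr hb, div_one, padicNorm.int_lt_one_iff]
  exact h.symm.dvd

end CongFive

/-- The coefficient of `X ^ n` in `recipSeries`, scaled by `5 ^ ⌊n/2⌋`. -/
def recipCoeff (n : ℕ) : ℚ := 5 ^ (n / 2) * ((-1) ^ n / ((2 * n + 1) * n.centralBinom : ℚ))

lemma factorization_five_lt_half {n : ℕ} (hn : 4 ≤ n) :
    ((2 * n + 1) * n.centralBinom).factorization 5 < n / 2 := by
  have h1 : n.centralBinom.factorization 5 ≤ Nat.log 5 (2 * n) :=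
    Nat.factorization_choose_le_log
  rw [Nat.factorization_mul (by lia) n.centralBinom_ne_zero, Finsupp.add_apply]
  rcases lt_or_ge n 6 with h6 | h6
  · have h2 : (2 * n + 1).factorization 5 = 0 := Nat.factorization_eq_zero_of_not_dvd (by lia)
    have h3 : Nat.log 5 (2 * n) < 2 := Nat.log_lt_of_lt_pow (by lia) (by lia)
    lia
  · have h2 : (2 * n + 1).factorization 5 ≤ Nat.log 5 (2 * n + 1) := by
      simpa using Nat.factorization_choose_le_log (p := 5) (n := 2 * n + 1) (k := 1)
    have h3 : Nat.log 5 (2 * n) ≤ Nat.log 5 (2 * n + 1) := Nat.log_mono_right (by lia)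
    have h4 : 5 ^ Nat.log 5 (2 * n + 1) ≤ 2 * n + 1 := Nat.pow_log_le_self 5 (by lia)
    have h5 : ∀ k, 2 ≤ k → 8 * k + 5 ≤ 5 ^ k := by
      intro k hk
      induction k, hk using Nat.le_induction with
      | base => norm_num
      | succ k _ ih => rw [pow_succ]; lia
    rcases lt_or_ge (Nat.log 5 (2 * n + 1)) 2 with h | h
    · lia
    · have := h5 _ h
      lia

lemma congFive_recipCoeff {n : ℕ} (hn : 4 ≤ n) : CongFive (recipCoeff n) 0 := by
  set N := (2 * n + 1) * n.centralBinom with hN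
  have hN0 : N ≠ 0 := mul_ne_zero (by lia) n.centralBinom_ne_zero
  have hv : N.factorization 5 < n / 2 := factorization_five_lt_half hn
  obtain ⟨k, hk⟩ := Nat.exists_eq_add_of_lt hv
  have h1 : 5 ^ N.factorization 5 * (N / 5 ^ N.factorization 5) = N :=
    Nat.ordProj_mul_ordCompl_eq_self N 5
  have h2 : ¬ 5 ∣ N / 5 ^ N.factorization 5 := Nat.not_dvd_ordCompl (by norm_num) hN0
  set M := N / 5 ^ N.factorization 5
  have hM0 : (M : ℚ) ≠ 0 := by
    intro h0
    exact h2 (by simp [Nat.cast_eq_zero.mp h0])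
  have h3 : recipCoeff n = ((5 * (5 ^ k * (-1) ^ n) : ℤ) : ℚ) / ((M : ℤ) : ℚ) := by
    have : ((2 * n + 1) * n.centralBinom : ℚ) = 5 ^ N.factorization 5 * M := by
      exact_mod_cast (h1.trans hN).symm
    rw [recipCoeff, this, hk]
    push_cast
    field_simp
    ring
  rw [h3]
  refine CongFive.div _ (by exact_mod_cast h2) ?_
  rw [zero_mul]
  exact (Int.modEq_zero_iff_dvd).mpr (dvd_mul_right _ _)

lemma congFive_recipCoeff_one : CongFive (recipCoeff 1) (-1) := by
  have : recipCoeff 1 = ((-1 : ℤ) : ℚ) / (6 : ℤ) := by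
    norm_num [recipCoeff, Nat.centralBinom]
  rw [this]
  exact CongFive.div _ (by decide) (by decide)

lemma congFive_recipCoeff_two : CongFive (recipCoeff 2) 1 := by
  have : recipCoeff 2 = ((1 : ℤ) : ℚ) / (6 : ℤ) := by
    norm_num [recipCoeff, Nat.centralBinom, Nat.choose]
  rw [this]
  exact CongFive.div _ (by decide) (by decide)

lemma congFive_recipCoeff_three : CongFive (recipCoeff 3) 3 := by
  have : recipCoeff 3 = ((-1 : ℤ) : ℚ) / (28 : ℤ) := by
    norm_num [recipCoeff, Nat.centralBinom, Nat.choose]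
  rw [this]
  exact CongFive.div _ (by decide) (by decide)

section

variable {ε : ℕ → ℚ}

lemma scaled_sum_eq_zero {l : ℕ}
    (h : ∑ n ∈ range (l + 1), (-1) ^ n / ((2 * n + 1) * n.centralBinom : ℚ) * ε (l - n) = 0) :
    ∑ n ∈ range (l + 1), 5 ^ (l / 2 - n / 2 - (l - n) / 2) *
      (recipCoeff n * (5 ^ ((l - n) / 2) * ε (l - n))) = 0 := by
  rw [← mul_zero (5 ^ (l / 2)), ← h, Finset.mul_sum]
  refine Finset.sum_congr rfl fun n hn => ?_
  rw [mem_range] at hn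
  have : l / 2 = (l / 2 - n / 2 - (l - n) / 2) + n / 2 + (l - n) / 2 := by lia
  conv_rhs => rw [this]
  rw [recipCoeff]
  ring

lemma congFive_step {l : ℕ} (hl : 3 ≤ l)
    (h : ∑ n ∈ range (l + 1), (-1) ^ n / ((2 * n + 1) * n.centralBinom : ℚ) * ε (l - n) = 0)
    (hint : ∀ j < l, ∃ m, CongFive (5 ^ (j / 2) * ε j) m) :
    CongFive (5 ^ (l / 2) * ε l +
      5 ^ (l / 2 - 1 / 2 - (l - 1) / 2) * (recipCoeff 1 * (5 ^ ((l - 1) / 2) * ε (l - 1))) +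
      recipCoeff 2 * (5 ^ ((l - 2) / 2) * ε (l - 2)) +
      5 ^ (l / 2 - 3 / 2 - (l - 3) / 2) * (recipCoeff 3 * (5 ^ ((l - 3) / 2) * ε (l - 3)))) 0 := by
  have h' := scaled_sum_eq_zero h
  obtain ⟨r, rfl⟩ := Nat.exists_eq_add_of_le hl
  rw [show 3 + r + 1 = 4 + r by ring, Finset.sum_range_add, Finset.sum_range_succ,
    Finset.sum_range_succ, Finset.sum_range_succ, Finset.sum_range_one] at h'
  have htail : CongFive (∑ x ∈ range r, 5 ^ ((3 + r) / 2 - (4 + x) / 2 - (3 + r - (4 + x)) / 2) *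
      (recipCoeff (4 + x) * (5 ^ ((3 + r - (4 + x)) / 2) * ε (3 + r - (4 + x))))) 0 := by
    rw [CongFive, Int.cast_zero, sub_zero]
    refine padicNorm.sum_lt' (fun x hx => ?_) one_pos
    rw [mem_range] at hx
    obtain ⟨m, hm⟩ := hint (3 + r - (4 + x)) (by lia)
    have h1 := (congFive_recipCoeff (n := 4 + x) (by lia)).mul hm
    have h2 : CongFive (5 ^ ((3 + r) / 2 - (4 + x) / 2 - (3 + r - (4 + x)) / 2))
      (5 ^ ((3 + r) / 2 - (4 + x) / 2 - (3 + r - (4 + x)) / 2)) := by simp [CongFive]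
    have := h2.mul h1
    simpa [CongFive] using this
  have := htail.neg
  rw [neg_zero] at this
  convert! this using 1
  have h2 : (3 + r) / 2 - 2 / 2 - (3 + r - 2) / 2 = 0 := by lia
  have h0 : (3 + r) / 2 - 0 / 2 - (3 + r - 0) / 2 = 0 := by lia
  rw [h2, h0, show recipCoeff 0 = 1 by simp [recipCoeff], Nat.sub_zero] at h'
  linear_combination h'

lemma congFive_scaled (hε : ε 0 = 1)
    (h : ∀ l ≠ 0, ∑ n ∈ range (l + 1),
      (-1) ^ n / ((2 * n + 1) * n.centralBinom : ℚ) * ε (l - n) = 0) (k : ℕ) :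
    CongFive (5 ^ k * ε (2 * k)) ((-1) ^ k) ∧
      CongFive (5 ^ k * ε (2 * k + 1)) ((-1) ^ k * (1 - k)) := by
  have e1 : ε 1 = 1 / 6 := by
    have := h 1 one_ne_zero
    norm_num [Finset.sum_range_succ, Nat.centralBinom, hε] at this
    linear_combination this
  have e2 : ε 2 = -1 / 180 := by
    have := h 2 two_ne_zero
    norm_num [Finset.sum_range_succ, Nat.centralBinom, Nat.choose, hε, e1] at this
    linear_combination this
  have h5 : CongFive 5 0 := by
    simpa [CongFive] using (padicNorm.nat_lt_one_iff (p := 5) 5).mpr dvd_rfl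
  induction k using Nat.strong_induction_on with
  | _ k ih =>
  rcases k with _ | k
  · refine ⟨by simp [CongFive, hε], ?_⟩
    simpa [e1] using CongFive.div 1 (b := 6) (m := 1) (by decide) (by decide)
  have hint : ∀ j < 2 * (k + 1), ∃ m, CongFive (5 ^ (j / 2) * ε j) m := by
    intro j hj
    obtain ⟨ha, hb⟩ := ih (j / 2) (by lia)
    rcases Nat.mod_two_eq_zero_or_one j with hj2 | hj2
    · exact ⟨_, by rwa [show 2 * (j / 2) = j by lia] at ha⟩
    · exact ⟨_, by rwa [show 2 * (j / 2) + 1 = j by lia] at hb⟩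
  obtain ⟨ha, hb⟩ := ih k (by lia)
  have heven : CongFive (5 ^ (k + 1) * ε (2 * (k + 1))) ((-1) ^ (k + 1)) := by
    rcases k with _ | k
    · have := CongFive.div (-1) (b := 36) (m := -1) (by decide) (by decide)
      convert! this using 1
      norm_num [e2]
    obtain ⟨-, hc⟩ := ih k (by lia)
    have hs := congFive_step (l := 2 * (k + 1 + 1)) (by lia) (h _ (by lia)) hint
    rw [show 2 * (k + 1 + 1) - 1 = 2 * (k + 1) + 1 by lia,
      show 2 * (k + 1 + 1) - 2 = 2 * (k + 1) by lia,
      show 2 * (k + 1 + 1) - 3 = 2 * k + 1 by lia,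
      show 2 * (k + 1 + 1) / 2 = k + 1 + 1 by lia,
      show (2 * (k + 1) + 1) / 2 = k + 1 by lia,
      show 2 * (k + 1) / 2 = k + 1 by lia,
      show (2 * k + 1) / 2 = k by lia,
      show k + 1 + 1 - 1 / 2 - (k + 1) = 1 by lia,
      show k + 1 + 1 - 3 / 2 - k = 1 by lia, pow_one] at hs
    have t1 := h5.mul (congFive_recipCoeff_one.mul hb)
    have t2 := congFive_recipCoeff_two.mul ha
    have t3 := h5.mul (congFive_recipCoeff_three.mul hc)
    have := (((hs.add t1.neg).add t2.neg).add t3.neg)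
    convert! this using 1
    · ring
    · ring
  refine ⟨heven, ?_⟩
  have hint' : ∀ j < 2 * (k + 1) + 1, ∃ m, CongFive (5 ^ (j / 2) * ε j) m := by
    intro j hj
    rcases Nat.lt_succ_iff_lt_or_eq.mp hj with hj | rfl
    · exact hint j hj
    · exact ⟨_, by rwa [show 2 * (k + 1) / 2 = k + 1 by lia]⟩
  have hs := congFive_step (l := 2 * (k + 1) + 1) (by lia) (h _ (by lia)) hint'
  rw [show 2 * (k + 1) + 1 - 1 = 2 * (k + 1) by lia,
    show 2 * (k + 1) + 1 - 2 = 2 * k + 1 by lia,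
    show 2 * (k + 1) + 1 - 3 = 2 * k by lia,
    show (2 * (k + 1) + 1) / 2 = k + 1 by lia,
    show 2 * (k + 1) / 2 = k + 1 by lia,
    show (2 * k + 1) / 2 = k by lia,
    show 2 * k / 2 = k by lia,
    show k + 1 - 1 / 2 - (k + 1) = 0 by lia,
    show k + 1 - 3 / 2 - k = 0 by lia, pow_zero, one_mul, one_mul] at hs
  have t1 := congFive_recipCoeff_one.mul heven
  have t2 := congFive_recipCoeff_two.mul hb
  have t3 := congFive_recipCoeff_three.mul ha
  have := (((hs.add t1.neg).add t2.neg).add t3.neg)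
  have h6 : CongFive (5 ^ (k + 1) * ε (2 * (k + 1) + 1))
      (0 + -(-1 * (-1) ^ (k + 1)) + -(1 * ((-1) ^ k * (1 - k))) + -(3 * (-1) ^ k)) := by
    convert! this using 1
    ring
  refine h6.congr (Int.modEq_iff_dvd.mpr ⟨(-1) ^ k, ?_⟩)
  push_cast
  ring

end

lemma padicValRat_five_of_congFive_scaled {q : ℚ} {m : ℤ} {a : ℕ} (h : CongFive (5 ^ a * q) m) :
    (¬ 5 ∣ m → padicValRat 5 q = -(a : ℤ) ∧ q ≠ 0) ∧
      (5 ∣ m → q = 0 ∨ -(a : ℤ) + 1 ≤ padicValRat 5 q) := by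
  have h5 : padicValRat 5 (5 : ℚ) = 1 := padicValRat.self (p := 5) (by norm_num)
  have hval (hq : q ≠ 0) : padicNorm 5 (5 ^ a * q) = 5 ^ (-((a : ℤ) + padicValRat 5 q)) := by
    rw [padicNorm.eq_zpow_of_nonzero (mul_ne_zero (by positivity) hq),
      padicValRat.mul (by positivity) hq, padicValRat.pow, h5, mul_one]
    norm_num
  constructor
  · intro hm
    have h1 : padicNorm 5 (m : ℚ) = 1 := (padicNorm.int_eq_one_iff m).mpr hm
    have h2 : padicNorm 5 (5 ^ a * q) = 1 := by
      have := padicNorm.add_eq_max_of_ne (p := 5) (q := 5 ^ a * q - m) (r := m)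
        (by rw [h1]; exact h.ne)
      rwa [sub_add_cancel, h1, max_eq_right h.le] at this
    have hq : q ≠ 0 := by
      rintro rfl
      simp at h2
    rw [hval hq, zpow_eq_one_iff_right₀ (by norm_num) (by norm_num)] at h2
    exact ⟨by lia, hq⟩
  · intro hm
    refine or_iff_not_imp_left.mpr fun hq => ?_
    have h1 : CongFive (5 ^ a * q) 0 := h.congr (Int.modEq_zero_iff_dvd.mpr hm)
    rw [CongFive, Int.cast_zero, sub_zero, hval hq, zpow_lt_one_iff_right₀ (by norm_num)] at h1
    lia

theorem padicValRat_five_epsilon (ε : ℕ → ℚ) (hε : IsEpsilon ε) (l : ℕ) (hl : 1 ≤ l) :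
    (¬ l % 10 = 3 → padicValRat 5 (ε l) = -((l / 2 : ℕ) : ℤ) ∧ ε l ≠ 0) ∧
      (l % 10 = 3 → ε l = 0 ∨ -((l / 2 : ℕ) : ℤ) + 1 ≤ padicValRat 5 (ε l)) := by
  obtain ⟨ha, hb⟩ := congFive_scaled hε.1 (fun _ hl => hε.sum_eq_zero hl) (l / 2)
  have hu : IsUnit ((-1 : ℤ) ^ (l / 2)) := isUnit_neg_one.pow _
  rcases Nat.mod_two_eq_zero_or_one l with hl | hl
  · rw [show 2 * (l / 2) = l by lia] at ha
    refine ⟨fun _ => (padicValRat_five_of_congFive_scaled ha).1 fun hd => ?_, by lia⟩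
    exact absurd (isUnit_of_dvd_unit hd hu) (by decide)
  · rw [show 2 * (l / 2) + 1 = l by lia] at hb
    have hdvd : (5 : ℤ) ∣ (-1) ^ (l / 2) * (1 - (l / 2 : ℕ)) ↔ l % 10 = 3 := by
      rw [hu.dvd_mul_left]
      lia
    have := padicValRat_five_of_congFive_scaled hb
    rwa [hdvd] at this
end
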